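/- arXiv:2212.06240 — 4 statements merged into one kernel-verified Lean document; each statement's English description precedes it below -/
import Mathlib

section
/- For every integer n ≥ 7: (2ⁿ+1)ⁿ · Σ_{k=0}^{n} binom(n,k)·(−1)^{n−k}·2^{−n(n−k)}·∏_{ℓ=0}^{k−1} (2^ℓ+1)/(2^ℓ+2ⁿ) ≥ 2^{n²/4}. -/
open Finset

theorem alternating_sum_succ (a : ℕ → ℝ) (m : ℕ) :
    ∑ k ∈ range (m + 2), (-1 : ℝ) ^ (m + 1 - k) * a k =
      a (m + 1) - ∑ k ∈ range (m + 1), (-1 : ℝ) ^ (m - k) * a k := by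
  have hs : ∑ k ∈ range (m + 1), (-1 : ℝ) ^ (m + 1 - k) * a k =
      -∑ k ∈ range (m + 1), (-1 : ℝ) ^ (m - k) * a k := by
    rw [← sum_neg_distrib]
    refine sum_congr rfl fun k hk => ?_
    rw [Nat.succ_sub (Nat.lt_succ_iff.mp (mem_range.mp hk)), pow_succ]
    ring
  rw [sum_range_succ, hs, Nat.sub_self]
  ring

/-- An alternating sum with nonnegative nondecreasing terms lies between zero and its last
term. -/
theorem alternating_sum_mem_Icc (a : ℕ → ℝ) (h0 : 0 ≤ a 0) (m : ℕ)
    (h : ∀ k < m, a k ≤ a (k + 1)) :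
    ∑ k ∈ range (m + 1), (-1 : ℝ) ^ (m - k) * a k ∈ Set.Icc 0 (a m) := by
  induction m with
  | zero => simpa using h0
  | succ m ih =>
    obtain ⟨h1, h2⟩ := ih fun k hk => h k (by omega)
    have hm := h m (by omega)
    rw [alternating_sum_succ]
    constructor <;> linarith

/-- An alternating sum with nonnegative nondecreasing terms is at least the difference of its
last two terms. -/
theorem sub_le_alternating_sum (a : ℕ → ℝ) (h0 : 0 ≤ a 0) (m : ℕ)
    (h : ∀ k < m, a k ≤ a (k + 1)) :
    a (m + 1) - a m ≤ ∑ k ∈ range (m + 2), (-1 : ℝ) ^ (m + 1 - k) * a k := by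
  rw [alternating_sum_succ]
  linarith [(alternating_sum_mem_Icc a h0 m h).2]

/-- The absolute value of the `k`-th summand of the `n`-th moment. -/
noncomputable def momentTerm (n k : ℕ) : ℝ :=
  (n.choose k : ℝ) * ((2 : ℝ) ^ (n * (n - k)))⁻¹ *
    ∏ ℓ ∈ range k, ((2 : ℝ) ^ ℓ + 1) / ((2 : ℝ) ^ ℓ + 2 ^ n)

theorem momentTerm_nonneg (n k : ℕ) : 0 ≤ momentTerm n k := by
  unfold momentTerm
  positivity

theorem two_pow_le_half_two_pow {n k : ℕ} (hk : k < n) : (2 : ℝ) ^ k ≤ 2 ^ n / 2 := by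
  have h : (2 : ℝ) ^ (k + 1) ≤ 2 ^ n := pow_le_pow_right₀ (by norm_num) hk
  rw [pow_succ] at h
  linarith

theorem momentTerm_ratio {n k : ℕ} (hk : k < n) :
    2 * ((2 : ℝ) ^ k + 1) * momentTerm n k ≤ 3 * ((k : ℝ) + 1) * momentTerm n (k + 1) := by
  have hc : (n.choose k : ℝ) ≤ n.choose (k + 1) * ((k : ℝ) + 1) := by
    have h := Nat.choose_succ_right_eq n k
    have h' : n.choose k ≤ n.choose (k + 1) * (k + 1) := by
      rw [h]
      exact Nat.le_mul_of_pos_right _ (by omega)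
    exact_mod_cast h'
  have he : n * (n - k) = n * (n - (k + 1)) + n := by
    rw [show n - k = n - (k + 1) + 1 by omega, Nat.mul_succ]
  unfold momentTerm
  rw [prod_range_succ, he, pow_add]
  set P := ∏ ℓ ∈ range k, ((2 : ℝ) ^ ℓ + 1) / ((2 : ℝ) ^ ℓ + 2 ^ n)
  have hP : 0 ≤ P := by positivity
  set Q := (2 : ℝ) ^ (n * (n - (k + 1)))
  have hQ : 0 < Q := by positivity
  have h2 := two_pow_le_half_two_pow hk
  have hx : (0 : ℝ) < 2 ^ k := by positivity
  have hy : (0 : ℝ) < 2 ^ n := by positivity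
  generalize (2 : ℝ) ^ k = x at *
  generalize (2 : ℝ) ^ n = y at *
  have hr : 2 * y⁻¹ ≤ 3 * (x + y)⁻¹ := by
    rw [← div_eq_mul_inv, ← div_eq_mul_inv, div_le_div_iff₀ hy (by linarith)]
    linarith
  calc 2 * (x + 1) * ((n.choose k : ℝ) * (Q * y)⁻¹ * P)
      = (n.choose k : ℝ) * (2 * y⁻¹) * (Q⁻¹ * P * (x + 1)) := by
        rw [mul_inv]
        ring
    _ ≤ n.choose (k + 1) * ((k : ℝ) + 1) * (3 * (x + y)⁻¹) * (Q⁻¹ * P * (x + 1)) := by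
        gcongr
    _ = _ := by
        rw [div_eq_mul_inv]
        ring

theorem three_mul_succ_le (k : ℕ) : 3 * ((k : ℝ) + 1) ≤ 2 * ((2 : ℝ) ^ k + 1) := by
  have h : 3 * (k + 1) ≤ 2 * (2 ^ k + 1) := by
    induction k with
    | zero => norm_num
    | succ k ih =>
      rcases k with _ | k
      · norm_num
      · rw [pow_succ]
        omega
  exact_mod_cast h

theorem three_mul_succ_le_half {k : ℕ} (hk : 6 ≤ k) :
    3 * ((k : ℝ) + 1) ≤ (2 : ℝ) ^ k + 1 := by
  have h : 3 * (k + 1) ≤ 2 ^ k + 1 := by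
    induction k, hk using Nat.le_induction with
    | base => norm_num
    | succ k hk ih =>
      rw [pow_succ]
      omega
  exact_mod_cast h

theorem momentTerm_le_succ {n k : ℕ} (hk : k < n) : momentTerm n k ≤ momentTerm n (k + 1) := by
  have h := (momentTerm_ratio hk).trans
    (mul_le_mul_of_nonneg_right (three_mul_succ_le k) (momentTerm_nonneg n (k + 1)))
  exact le_of_mul_le_mul_left h (by positivity)

theorem two_mul_momentTerm_le_succ {n k : ℕ} (hk : k < n) (h6 : 6 ≤ k) :
    2 * momentTerm n k ≤ momentTerm n (k + 1) := by
  have h := (momentTerm_ratio hk).trans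
    (mul_le_mul_of_nonneg_right (three_mul_succ_le_half h6) (momentTerm_nonneg n (k + 1)))
  refine le_of_mul_le_mul_left (a := (2 : ℝ) ^ k + 1) ?_ (by positivity)
  linarith

theorem prod_le_pow_mul_momentTerm_self (n : ℕ) :
    ∏ ℓ ∈ range n, (2 : ℝ) ^ ℓ / 2 ≤ ((2 : ℝ) ^ n + 1) ^ n * momentTerm n n := by
  have h : ((2 : ℝ) ^ n + 1) ^ n * momentTerm n n =
      ∏ ℓ ∈ range n, ((2 : ℝ) ^ n + 1) * (((2 : ℝ) ^ ℓ + 1) / ((2 : ℝ) ^ ℓ + 2 ^ n)) := by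
    simp [momentTerm, prod_mul_distrib]
  rw [h]
  refine prod_le_prod (fun _ _ => by positivity) fun ℓ hℓ => ?_
  have h2 := two_pow_le_half_two_pow (mem_range.mp hℓ)
  have hx : (0 : ℝ) < 2 ^ ℓ := by positivity
  have hy : (0 : ℝ) < 2 ^ n := by positivity
  rw [← mul_div_assoc, div_le_div_iff₀ two_pos (by positivity)]
  nlinarith [mul_pos hx hy]

theorem two_rpow_sq_div_four_le {n : ℕ} (hn : 7 ≤ n) :
    (2 : ℝ) ^ ((n : ℝ) ^ 2 / 4) ≤ (∏ ℓ ∈ range n, (2 : ℝ) ^ ℓ / 2) / 2 := by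
  have hp : (∏ ℓ ∈ range n, (2 : ℝ) ^ ℓ / 2) / 2 =
      (2 : ℝ) ^ ((n : ℝ) * (n - 1) / 2 - n - 1) := by
    have hsum : ((∑ ℓ ∈ range n, ℓ : ℕ) : ℝ) = (n : ℝ) * (n - 1) / 2 := by
      have h := congrArg (Nat.cast (R := ℝ)) (sum_range_id_mul_two n)
      push_cast [Nat.cast_sub (show 1 ≤ n by omega)] at h ⊢
      linarith
    rw [prod_div_distrib, prod_pow_eq_pow_sum, prod_const, card_range,
      Real.rpow_sub two_pos, Real.rpow_sub two_pos, ← hsum, Real.rpow_natCast,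
      Real.rpow_natCast, Real.rpow_one]
  rw [hp]
  refine Real.rpow_le_rpow_of_exponent_le one_le_two ?_
  have h7 : (7 : ℝ) ≤ n := by exact_mod_cast hn
  nlinarith

/-- **Super-exponential lower bound on the `n`-th moment of Clifford shadow estimation.**
For every integer `n ≥ 7`,
`(2ⁿ+1)ⁿ · Σ_{k=0}^{n} binom(n,k)·(−1)^{n−k}·2^{−n(n−k)}·∏_{ℓ=0}^{k−1} (2^ℓ+1)/(2^ℓ+2ⁿ) ≥ 2^{n²/4}`. -/
theorem clifford_moment_lower_bound (n : ℕ) (hn : 7 ≤ n) :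
    (2 : ℝ) ^ ((n : ℝ) ^ 2 / 4) ≤
      ((2 : ℝ) ^ n + 1) ^ n *
        ∑ k ∈ Finset.range (n + 1),
          (n.choose k : ℝ) * (-1 : ℝ) ^ (n - k) * ((2 : ℝ) ^ (n * (n - k)))⁻¹ *
            ∏ ℓ ∈ Finset.range k, ((2 : ℝ) ^ ℓ + 1) / ((2 : ℝ) ^ ℓ + 2 ^ n) := by
  obtain ⟨m, rfl⟩ : ∃ m, n = m + 1 := ⟨n - 1, by omega⟩
  have hs := sub_le_alternating_sum (momentTerm (m + 1)) (momentTerm_nonneg _ _) m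
    fun k hk => momentTerm_le_succ (hk.trans (Nat.lt_succ_self m))
  have hlast := two_mul_momentTerm_le_succ (Nat.lt_succ_self m) (show 6 ≤ m by omega)
  calc (2 : ℝ) ^ (((m + 1 : ℕ) : ℝ) ^ 2 / 4)
      ≤ (∏ ℓ ∈ range (m + 1), (2 : ℝ) ^ ℓ / 2) / 2 := two_rpow_sq_div_four_le hn
    _ ≤ ((2 : ℝ) ^ (m + 1) + 1) ^ (m + 1) * momentTerm (m + 1) (m + 1) / 2 := by
        gcongr
        exact prod_le_pow_mul_momentTerm_self (m + 1)
    _ = ((2 : ℝ) ^ (m + 1) + 1) ^ (m + 1) * (momentTerm (m + 1) (m + 1) / 2) := by ring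
    _ ≤ ((2 : ℝ) ^ (m + 1) + 1) ^ (m + 1) *
          ∑ k ∈ range (m + 2), (-1 : ℝ) ^ (m + 1 - k) * momentTerm (m + 1) k := by
        gcongr
        linarith
    _ = _ := by
        congr 1
        refine sum_congr rfl fun k _ => ?_
        unfold momentTerm
        ring
end

section
/- For every fixed integer m ≥ 0: lim_{n→∞} (2ⁿ+1)^m · Σ_{k=0}^{m} binom(m,k)·(−1)^{m−k}·2^{−n(m−k)}·∏_{ℓ=0}^{k−1} (2^ℓ+1)/(2^ℓ+2ⁿ) = Σ_{k=0}^{m} binom(m,k)·(−1)^{m−k}·∏_{ℓ=0}^{k−1} (2^ℓ+1). -/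
open Finset Filter

/-- For fixed `c ≥ 0`, the ratio `(2ⁿ + 1) / (c + 2ⁿ)` tends to `1`. -/
theorem tendsto_two_pow_add_one_div {c : ℝ} (hc : 0 ≤ c) :
    Tendsto (fun n : ℕ => ((2 : ℝ) ^ n + 1) / (c + 2 ^ n)) atTop (nhds 1) := by
  have h : Tendsto (fun n : ℕ => ((2 : ℝ) ^ n)⁻¹) atTop (nhds 0) :=
    (tendsto_pow_atTop_atTop_of_one_lt one_lt_two).inv_tendsto_atTop
  have hlim := (h.const_add 1).div ((h.const_mul c).add_const 1) (by simp)
  simp only [add_zero, mul_zero, zero_add, div_one] at hlim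
  refine hlim.congr fun n => ?_
  have hpos : (0 : ℝ) < 2 ^ n := by positivity
  simp only [Pi.div_apply]
  field_simp

/-- **Limiting moments of Clifford shadow estimation** (Corollary 6 of the paper,
limit formula).  For every fixed `m ≥ 0`, the `m`-th moment
`(2ⁿ+1)^m · Σ_{k=0}^{m} binom(m,k)·(−1)^{m−k}·2^{−n(m−k)}·∏_{ℓ=0}^{k−1} (2^ℓ+1)/(2^ℓ+2ⁿ)`
converges, as the number of qubits `n → ∞`, to
`Σ_{k=0}^{m} binom(m,k)·(−1)^{m−k}·∏_{ℓ=0}^{k−1} (2^ℓ+1)`. -/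
theorem clifford_limiting_moments (m : ℕ) :
    Tendsto
      (fun n : ℕ =>
        ((2 : ℝ) ^ n + 1) ^ m *
          ∑ k ∈ Finset.range (m + 1),
            (m.choose k : ℝ) * (-1 : ℝ) ^ (m - k) * ((2 : ℝ) ^ (n * (m - k)))⁻¹ *
              ∏ ℓ ∈ Finset.range k, ((2 : ℝ) ^ ℓ + 1) / ((2 : ℝ) ^ ℓ + 2 ^ n))
      atTop
      (nhds (∑ k ∈ Finset.range (m + 1),
        (m.choose k : ℝ) * (-1 : ℝ) ^ (m - k) *
          ∏ ℓ ∈ Finset.range k, ((2 : ℝ) ^ ℓ + 1))) := by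
  simp_rw [Finset.mul_sum]
  refine tendsto_finsetSum _ fun k hk => ?_
  have hkm : m - k + k = m := Nat.sub_add_cancel (Nat.lt_succ_iff.mp (Finset.mem_range.mp hk))
  have hpow : Tendsto (fun n : ℕ => (((2 : ℝ) ^ n + 1) / (0 + 2 ^ n)) ^ (m - k)) atTop (nhds 1) := by
    simpa using (tendsto_two_pow_add_one_div le_rfl).pow (m - k)
  have hprod : Tendsto
      (fun n : ℕ => ∏ ℓ ∈ Finset.range k,
        (((2 : ℝ) ^ ℓ + 1) * (((2 : ℝ) ^ n + 1) / ((2 : ℝ) ^ ℓ + 2 ^ n))))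
      atTop (nhds (∏ ℓ ∈ Finset.range k, ((2 : ℝ) ^ ℓ + 1))) := by
    refine tendsto_finsetProd _ fun ℓ _ => ?_
    simpa using (tendsto_two_pow_add_one_div (c := (2 : ℝ) ^ ℓ) (by positivity)).const_mul
      ((2 : ℝ) ^ ℓ + 1)
  have hlim := (hpow.const_mul ((m.choose k : ℝ) * (-1 : ℝ) ^ (m - k))).mul hprod
  rw [mul_one] at hlim
  refine hlim.congr fun n => ?_
  have hsplit : ((2 : ℝ) ^ n + 1) ^ m = (2 ^ n + 1) ^ (m - k) * (2 ^ n + 1) ^ k := by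
    rw [← pow_add, hkm]
  rw [hsplit, zero_add, div_pow, pow_mul]
  simp only [Finset.prod_mul_distrib, Finset.prod_div_distrib, Finset.prod_const,
    Finset.card_range]
  ring
end

section
/- For every integer m ≥ 6: Σ_{k=0}^{m} binom(m,k)·(−1)^{m−k}·∏_{ℓ=0}^{k−1} (2^ℓ+1) ≥ 2^{m(m−1)/2}. -/
open Finset

/-- If the iterated forward differences of `f` of order at most `m` are nonnegative, then the
`m`-th difference of `2 ^ x * f x` is at least `2 ^ (m + n)` times that of `f` at `n`. -/
theorem two_pow_mul_fwdDiff_iter_le (m : ℕ) (f : ℕ → ℝ)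
    (hf : ∀ j ≤ m, ∀ n, 0 ≤ (fwdDiff 1)^[j] f n) (n : ℕ) :
    (2 : ℝ) ^ (m + n) * (fwdDiff 1)^[m] f n ≤ (fwdDiff 1)^[m] (fun x ↦ 2 ^ x * f x) n := by
  induction m generalizing f with
  | zero => simp
  | succ m ih =>
    have hstep : fwdDiff 1 (fun x ↦ (2 : ℝ) ^ x * f x) =
        fun x ↦ 2 ^ x * ((2 : ℝ) • fwdDiff 1 f + f) x := by
      funext x
      simp only [fwdDiff, Pi.add_apply, Pi.smul_apply, smul_eq_mul]
      ring
    have hiter : ∀ j x, (fwdDiff 1)^[j] ((2 : ℝ) • fwdDiff 1 f + f) x =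
        2 * (fwdDiff 1)^[j + 1] f x + (fwdDiff 1)^[j] f x := by
      intro j x
      rw [fwdDiff_iter_add, fwdDiff_iter_const_smul, Function.iterate_succ_apply]
      simp
    have key := ih ((2 : ℝ) • fwdDiff 1 f + f) fun j hj x ↦ by
      rw [hiter]
      linarith [hf (j + 1) (by omega) x, hf j (by omega) x]
    rw [hiter] at key
    rw [Function.iterate_succ_apply _ _ (fun x ↦ (2 : ℝ) ^ x * f x), hstep]
    refine le_trans ?_ key
    have h := mul_nonneg (pow_nonneg (zero_le_two (α := ℝ)) (m + n)) (hf m (by omega) n)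
    rw [show m + 1 + n = (m + n) + 1 by omega, pow_succ]
    linarith

theorem fwdDiff_prod_two_pow_add_one :
    fwdDiff 1 (fun k : ℕ ↦ ∏ ℓ ∈ range k, ((2 : ℝ) ^ ℓ + 1)) =
      fun k ↦ 2 ^ k * ∏ ℓ ∈ range k, ((2 : ℝ) ^ ℓ + 1) := by
  funext k
  simp only [fwdDiff, prod_range_succ]
  ring

theorem fwdDiff_iter_prod_two_pow_add_one_nonneg (m n : ℕ) :
    0 ≤ (fwdDiff 1)^[m] (fun k : ℕ ↦ ∏ ℓ ∈ range k, ((2 : ℝ) ^ ℓ + 1)) n := by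
  induction m using Nat.strong_induction_on generalizing n with
  | _ m ih =>
    cases m with
    | zero => exact prod_nonneg fun _ _ ↦ by positivity
    | succ m =>
      rw [Function.iterate_succ_apply, fwdDiff_prod_two_pow_add_one]
      exact (mul_nonneg (by positivity) (ih m (by omega) n)).trans
        (two_pow_mul_fwdDiff_iter_le m _ (fun j hj n ↦ ih j (by omega) n) n)

theorem two_pow_le_fwdDiff_iter_prod_two_pow_add_one (m : ℕ) :
    (2 : ℝ) ^ (m * (m - 1) / 2) ≤
      (fwdDiff 1)^[m] (fun k : ℕ ↦ ∏ ℓ ∈ range k, ((2 : ℝ) ^ ℓ + 1)) 0 := by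
  rw [← sum_range_id]
  induction m with
  | zero => simp
  | succ m ih =>
    rw [Function.iterate_succ_apply, fwdDiff_prod_two_pow_add_one, sum_range_succ, add_comm,
      pow_add]
    exact (mul_le_mul_of_nonneg_left ih (by positivity)).trans
      (two_pow_mul_fwdDiff_iter_le m _
        (fun j _ n ↦ fwdDiff_iter_prod_two_pow_add_one_nonneg j n) 0)

/-- **Super-exponential growth of the limiting moments of Clifford shadow estimation**
(Corollary 6 of the paper, lower bound).  For every integer `m ≥ 6`,
`Σ_{k=0}^{m} binom(m,k)·(−1)^{m−k}·∏_{ℓ=0}^{k−1} (2^ℓ+1) ≥ 2^{m(m−1)/2}`. -/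
theorem clifford_limiting_moments_lower_bound (m : ℕ) (hm : 6 ≤ m) :
    (2 : ℝ) ^ (m * (m - 1) / 2) ≤
      ∑ k ∈ Finset.range (m + 1),
        (m.choose k : ℝ) * (-1 : ℝ) ^ (m - k) *
          ∏ ℓ ∈ Finset.range k, ((2 : ℝ) ^ ℓ + 1) := by
  refine (two_pow_le_fwdDiff_iter_prod_two_pow_add_one m).trans_eq ?_
  rw [fwdDiff_iter_eq_sum_shift]
  refine sum_congr rfl fun k _ ↦ ?_
  simp only [zero_add, smul_eq_mul, mul_one, zsmul_eq_mul]
  push_cast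
  ring
end

section
/- Let n ≥ 1 and let x, x̂ ∈ {0,1}ⁿ index computational basis vectors of ℂ^{2ⁿ}. For every permutation π in the subgroup S₃ ⊆ S₄ (permutations of {1,2,3,4} fixing 4): 2^{−n} · Σ_{P∈𝒫_n} tr( (|x⟩⟨x| ⊗ |x⟩⟨x| ⊗ |x̂⟩⟨x̂| ⊗ |x̂⟩⟨x̂|) · R_π · P^{⊗4} ) = 1 if π ∈ {e, (12)}, and equals δ_{x,x̂} for every other π ∈ S₃. Here R_π is the operator on (ℂ^{2ⁿ})^{⊗4} permuting the four tensor factors according to π. -/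
open Matrix BigOperators

/-- Computational-basis index set for `n` qubits: `{0,1}ⁿ`. -/
abbrev QIdx (n : ℕ) := Fin n → Fin 2

/-- The four single-qubit Pauli matrices `I, X, Y, Z`. -/
noncomputable def pauli1 : Fin 4 → Matrix (Fin 2) (Fin 2) ℂ
  | 0 => 1
  | 1 => !![0, 1; 1, 0]
  | 2 => !![0, -Complex.I; Complex.I, 0]
  | 3 => !![1, 0; 0, -1]

/-- The `n`-qubit Pauli operator determined by `p : Fin n → Fin 4`; as `p` ranges over
`Fin n → Fin 4` this enumerates the `4ⁿ` elements of `𝒫_n`. -/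
noncomputable def pauliTP {n : ℕ} (p : Fin n → Fin 4) : Matrix (QIdx n) (QIdx n) ℂ :=
  fun x y => ∏ i, pauli1 (p i) (x i) (y i)

/-- The fourth Kronecker power `M^{⊗4}` of an `n`-qubit operator. -/
noncomputable def kron4 {n : ℕ} (M : Matrix (QIdx n) (QIdx n) ℂ) :
    Matrix (Fin 4 → QIdx n) (Fin 4 → QIdx n) ℂ :=
  fun x y => ∏ j, M (x j) (y j)

/-- The operator on `(ℂ^{2ⁿ})^{⊗4}` permuting the four tensor factors according to `π`. -/
noncomputable def permOp (n : ℕ) (π : Equiv.Perm (Fin 4)) :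
    Matrix (Fin 4 → QIdx n) (Fin 4 → QIdx n) ℂ :=
  fun z y => if z = y ∘ π then 1 else 0

/-- The rank-one projector `|x⟩⟨x| ⊗ |x⟩⟨x| ⊗ |x̂⟩⟨x̂| ⊗ |x̂⟩⟨x̂|` on `(ℂ^{2ⁿ})^{⊗4}`. -/
noncomputable def basisProj4 {n : ℕ} (x xh : QIdx n) :
    Matrix (Fin 4 → QIdx n) (Fin 4 → QIdx n) ℂ :=
  fun a b => if a = ![x, x, xh, xh] ∧ b = ![x, x, xh, xh] then 1 else 0

/-- A permutation of `Fin 4` fixing `3` is the identity or `swap 0 1` iff its inverse fixes `2`. -/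
theorem eq_one_or_eq_swap_iff {π : Equiv.Perm (Fin 4)} (hπ : π 3 = 3) :
    (π = 1 ∨ π = Equiv.swap 0 1) ↔ π⁻¹ 2 = 2 := by
  revert π
  decide

theorem trace_basisProj4_mul_permOp_mul {n : ℕ} (x xh : QIdx n) (π : Equiv.Perm (Fin 4))
    (K : Matrix (Fin 4 → QIdx n) (Fin 4 → QIdx n) ℂ) :
    (basisProj4 x xh * permOp n π * K).trace =
      K (![x, x, xh, xh] ∘ ⇑π⁻¹) ![x, x, xh, xh] := by
  have hcomp (v y : Fin 4 → QIdx n) : v = y ∘ π ↔ y = v ∘ ⇑π⁻¹ :=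
    eq_comm.trans (Equiv.eq_comp_symm π y v).symm
  have hBR (a y : Fin 4 → QIdx n) : (basisProj4 x xh * permOp n π) a y =
      if a = ![x, x, xh, xh] then permOp n π ![x, x, xh, xh] y else 0 := by
    simp [Matrix.mul_apply, basisProj4, ite_and]
  simp only [Matrix.trace, Matrix.diag_apply, Matrix.mul_apply (N := K), hBR, ite_mul, zero_mul]
  rw [Finset.sum_comm]
  simp [permOp, hcomp]

/-- The sum over single-qubit Paulis of the product of four matrix entries. -/
theorem sum_prod_pauli1 (a b : Fin 2) {π : Equiv.Perm (Fin 4)} (hπ : π 3 = 3) :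
    ∑ q, ∏ j, pauli1 q (![a, a, b, b] (π⁻¹ j)) (![a, a, b, b] j) =
      if π⁻¹ 2 = 2 ∨ a = b then 2 else 0 := by
  have v0 : (![a, a, b, b] : Fin 4 → Fin 2) 0 = a := rfl
  have v1 : (![a, a, b, b] : Fin 4 → Fin 2) 1 = a := rfl
  have v2 : (![a, a, b, b] : Fin 4 → Fin 2) 2 = b := rfl
  have v3 : (![a, a, b, b] : Fin 4 → Fin 2) 3 = b := rfl
  split_ifs with h
  · have hw : ∀ j, (![a, a, b, b] : Fin 4 → Fin 2) (π⁻¹ j) = ![a, a, b, b] j := by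
      rcases h with h | rfl
      · rcases (eq_one_or_eq_swap_iff hπ).2 h with rfl | rfl <;> clear v0 v1 v2 v3 <;> revert a b <;> decide
      · intro j
        have hc : ∀ k, (![a, a, a, a] : Fin 4 → Fin 2) k = a := by revert a; decide
        rw [hc, hc]
    simp only [hw, Fin.sum_univ_four, Fin.prod_univ_four, v0, v1, v2, v3]
    clear h hw v0 v1 v2 v3
    revert a b
    simp only [Fin.forall_fin_two]
    norm_num [pauli1]
  · push Not at h
    have h3 : π⁻¹ 3 = 3 := Equiv.Perm.inv_eq_iff_eq.2 hπ.symm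
    have h2 : (![a, a, b, b] : Fin 4 → Fin 2) (π⁻¹ 2) = a := by
      have hne : π⁻¹ 2 ≠ 3 := fun hc => absurd (π⁻¹.injective (hc.trans h3.symm)) (by decide)
      have key : ∀ k : Fin 4, k ≠ 2 → k ≠ 3 → (![a, a, b, b] : Fin 4 → Fin 2) k = a := by
        clear h v0 v1 v2 v3
        revert a b; decide
      exact key _ h.1 hne
    have hab := h.2
    simp only [Fin.sum_univ_four, Fin.prod_univ_four, h2, h3, v0, v1, v2, v3]
    generalize (![a, a, b, b] : Fin 4 → Fin 2) (π⁻¹ 0) = c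
    generalize (![a, a, b, b] : Fin 4 → Fin 2) (π⁻¹ 1) = d
    clear h h2 v0 v1 v2 v3
    revert a b
    simp [Fin.forall_fin_two, pauli1]

/-- The Pauli sum factorizes over the qubits. -/
theorem sum_trace_kron4_pauliTP {n : ℕ} (x xh : QIdx n) {π : Equiv.Perm (Fin 4)}
    (hπ : π 3 = 3) :
    ∑ p : Fin n → Fin 4, (basisProj4 x xh * permOp n π * kron4 (pauliTP p)).trace =
      ∏ i, if π⁻¹ 2 = 2 ∨ x i = xh i then (2 : ℂ) else 0 := by
  have hv (i : Fin n) (k : Fin 4) :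
      (![x, x, xh, xh] : Fin 4 → QIdx n) k i = ![x i, x i, xh i, xh i] k := by
    fin_cases k <;> rfl
  simp only [trace_basisProj4_mul_permOp_mul, kron4, pauliTP, Function.comp_apply, hv,
    ← sum_prod_pauli1 _ _ hπ]
  rw [Fintype.prod_sum]
  exact Finset.sum_congr rfl fun p _ => Finset.prod_comm

/-- **Pauli part of Lemma (v_bound 2)**: for computational basis vectors `|x⟩, |x̂⟩` and any
`π` in the subgroup `S₃ ⊆ S₄` of permutations fixing the fourth factor,
`2^{−n}·Σ_{P∈𝒫_n} tr((|x⟩⟨x|⊗|x⟩⟨x|⊗|x̂⟩⟨x̂|⊗|x̂⟩⟨x̂|)·R_π·P^{⊗4})` equals `1` if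
`π ∈ {e, (12)}` and equals `δ_{x,x̂}` for every other `π ∈ S₃`. -/
theorem pauli_basis_overlap (n : ℕ) (hn : 1 ≤ n) (x xh : QIdx n)
    (π : Equiv.Perm (Fin 4)) (hπ : π 3 = 3) :
    ((π = 1 ∨ π = Equiv.swap 0 1) →
      ((2 : ℂ) ^ n)⁻¹ *
        ∑ p : Fin n → Fin 4,
          (basisProj4 x xh * permOp n π * kron4 (pauliTP p)).trace = 1) ∧
    (¬ (π = 1 ∨ π = Equiv.swap 0 1) →
      ((2 : ℂ) ^ n)⁻¹ *
        ∑ p : Fin n → Fin 4,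
          (basisProj4 x xh * permOp n π * kron4 (pauliTP p)).trace =
        if x = xh then 1 else 0) := by
  rw [sum_trace_kron4_pauliTP x xh hπ, eq_one_or_eq_swap_iff hπ]
  refine ⟨fun h => by simp [h], fun h => ?_⟩
  split_ifs with hx
  · simp [hx]
  · obtain ⟨i, hi⟩ := Function.ne_iff.1 hx
    rw [Finset.prod_eq_zero (Finset.mem_univ i) (if_neg (not_or.2 ⟨h, hi⟩)), mul_zero]
end
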